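/- arXiv:2506.09474 — 3 statements merged into one kernel-verified Lean document; each statement's English description precedes it below -/
import Mathlib

section
/- Let η ∈ (0,1) and n̄_B > 0 be real numbers, and set x = η·n̄_B. Then the series ∑_{m=0}^∞ a_m²/b_m converges and equals 1 + (1−η)²/(4x(1+x)). Equivalently, the χ²-divergence ∑_{m=0}^∞ a_m²/b_m − 1 between Willie's twirled single-rail output distribution (a_m) and the attenuated thermal distribution (b_m) equals (1−η)²/(4·η·n̄_B·(1+η·n̄_B)). -/
theorem hasSum_sq_mul_geometric {r : ℝ} (hr : ‖r‖ < 1) :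
    HasSum (fun n : ℕ => (n : ℝ) ^ 2 * r ^ n) (r * (1 + r) / (1 - r) ^ 3) := by
  have hr1 : 1 - r ≠ 0 := by
    have := (abs_lt.mp hr).2
    linarith
  convert! (((hasSum_choose_mul_geometric_of_norm_lt_one 2 hr).mul_left 2).sub
    ((hasSum_coe_mul_geometric_of_norm_lt_one hr).mul_left 3)).sub
    ((hasSum_geometric_of_norm_lt_one hr).mul_left 2) using 1
  · ext n
    rw [Nat.cast_choose_two]
    push_cast
    ring
  · field_simp
    ring

/-- The second moment about an affine function of the geometric (thermal) distribution with
mean `x`. -/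
theorem hasSum_thermal_mul_affine_sq {x : ℝ} (hx : 0 < x) (d : ℝ) :
    HasSum (fun m : ℕ => x ^ m / (1 + x) ^ (m + 1) * (1 + d * (m - x)) ^ 2)
      (1 + d ^ 2 * (x * (1 + x))) := by
  have hx1 : 1 + x ≠ 0 := by positivity
  have hr : ‖x / (1 + x)‖ < 1 := by
    rw [Real.norm_of_nonneg (by positivity), div_lt_one (by positivity)]
    linarith
  have hsub : 1 - x / (1 + x) = 1 / (1 + x) := by
    field_simp
    ring
  convert! (((hasSum_geometric_of_norm_lt_one hr).mul_left ((1 - d * x) ^ 2 / (1 + x))).add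
    ((hasSum_coe_mul_geometric_of_norm_lt_one hr).mul_left (2 * d * (1 - d * x) / (1 + x)))).add
    ((hasSum_sq_mul_geometric hr).mul_left (d ^ 2 / (1 + x))) using 1
  · ext m
    rw [div_pow]
    field_simp
    ring
  · rw [hsub]
    field_simp
    ring


/-- For `η ∈ (0,1)`, `n̄_B > 0`, `x = η·n̄_B`, the series
`∑ a_m² / b_m` converges and equals `1 + (1−η)²/(4x(1+x))`, where
`b_m = x^m/(1+x)^(m+1)` is the attenuated thermal distribution and
`a_m = b_m + ((1−η)/2)·(m·x^(m−1) − x^m)/(1+x)^(m+2)` is Willie's twirled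
single-rail output distribution (with `m·x^(m−1) = 0` at `m = 0`). -/
theorem stmt_0 (η nB : ℝ) (hη0 : 0 < η) (hη1 : η < 1) (hnB : 0 < nB) :
    HasSum
      (fun m : ℕ =>
        ((η * nB) ^ m / (1 + η * nB) ^ (m + 1)
            + ((1 - η) / 2) *
                (((m : ℝ) * (η * nB) ^ (m - 1) - (η * nB) ^ m) / (1 + η * nB) ^ (m + 2))) ^ 2
          / ((η * nB) ^ m / (1 + η * nB) ^ (m + 1)))
      (1 + (1 - η) ^ 2 / (4 * (η * nB) * (1 + η * nB))) := by
  have hx : 0 < η * nB := mul_pos hη0 hnB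
  generalize η * nB = x at hx ⊢
  have hx1 : 1 + x ≠ 0 := by positivity
  convert! hasSum_thermal_mul_affine_sq hx ((1 - η) / 2 / (x * (1 + x))) using 1
  · ext m
    have hm : (m : ℝ) * x ^ (m - 1) = m * x ^ m / x := by
      cases m with
      | zero => simp
      | succ k =>
        rw [Nat.add_sub_cancel, pow_succ]
        field_simp
    rw [hm]
    field_simp
    ring
  · field_simp
    ring
end

section
/- Let n ≥ 1, q ∈ (0,1), and ϑ > 0. For x ∈ {0,1}ⁿ let w(x) be its Hamming weight, let P(x) = q^{w(x)}·(1−q)^{n−w(x)} be the i.i.d. Bernoulli(q) distribution, let 𝒜 = {x ∈ {0,1}ⁿ : |w(x)/n − q| ≤ ϑ}, assume P(𝒜) > 0, and let p_𝐗(x) = P(x)·𝟙[x ∈ 𝒜]/P(𝒜) be the conditioned distribution. Then (1/2)·∑_{x∈{0,1}ⁿ} |P(x) − p_𝐗(x)| ≤ 2·exp(−(1/3)·q·n·ϑ²). -/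
/-- Hamming weight of a binary string `x ∈ {0,1}ⁿ` (number of ones). -/
def hammingWt {n : ℕ} (x : Fin n → Bool) : ℕ :=
  (Finset.univ.filter (fun i => x i = true)).card

/-- The i.i.d. Bernoulli(q) distribution on `{0,1}ⁿ`:
`P(x) = q^{w(x)}·(1−q)^{n−w(x)}`. -/
noncomputable def Pber (n : ℕ) (q : ℝ) (x : Fin n → Bool) : ℝ :=
  q ^ hammingWt x * (1 - q) ^ (n - hammingWt x)

/-- The typical set `𝒜 = {x : |w(x)/n − q| ≤ ϑ}`. -/
noncomputable def Aset (n : ℕ) (q ϑ : ℝ) : Finset (Fin n → Bool) :=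
  Finset.univ.filter (fun x => |(hammingWt x : ℝ) / n - q| ≤ ϑ)

open Finset Real

/-- A product weight over a binary string depends only on its Hamming weight. -/
theorem prod_bool_eq_pow_hammingWt {n : ℕ} (a b : ℝ) (x : Fin n → Bool) :
    ∏ i, (if x i = true then a else b) = a ^ hammingWt x * b ^ (n - hammingWt x) := by
  have h := card_filter_add_card_filter_not (s := (univ : Finset (Fin n))) (fun i => x i = true)
  rw [card_univ, Fintype.card_fin] at h
  rw [prod_ite, prod_const, prod_const, hammingWt]
  congr 2
  omega

theorem hammingWt_le {n : ℕ} (x : Fin n → Bool) : hammingWt x ≤ n := by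
  simpa [hammingWt] using card_filter_le (univ : Finset (Fin n)) (fun i => x i = true)

/-- The binomial theorem, as a sum over binary strings. -/
theorem sum_pow_hammingWt (n : ℕ) (a b : ℝ) :
    ∑ x : Fin n → Bool, a ^ hammingWt x * b ^ (n - hammingWt x) = (a + b) ^ n := by
  have h := Fintype.sum_pow (fun c : Bool => if c = true then a else b) n
  simp only [prod_bool_eq_pow_hammingWt] at h
  rw [← h]
  simp

theorem sum_Pber (n : ℕ) (q : ℝ) : ∑ x, Pber n q x = 1 := by
  simp [Pber, sum_pow_hammingWt]

theorem Pber_nonneg {n : ℕ} {q : ℝ} (hq0 : 0 ≤ q) (hq1 : q ≤ 1) (x : Fin n → Bool) :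
    0 ≤ Pber n q x :=
  mul_nonneg (pow_nonneg hq0 _) (pow_nonneg (sub_nonneg.2 hq1) _)

/-- The moment generating function of the centred Hamming weight. -/
theorem sum_Pber_mul_exp (n : ℕ) (q t : ℝ) :
    ∑ x : Fin n → Bool, Pber n q x * exp (t * (hammingWt x - n * q)) =
      (q * exp (t * (1 - q)) + (1 - q) * exp (-(t * q))) ^ n := by
  rw [← sum_pow_hammingWt]
  refine sum_congr rfl fun x _ => ?_
  have h : exp (t * (hammingWt x - n * q)) =
      exp (t * (1 - q)) ^ hammingWt x * exp (-(t * q)) ^ (n - hammingWt x) := by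
    rw [← exp_nat_mul, ← exp_nat_mul, ← exp_add, Nat.cast_sub (hammingWt_le x)]
    congr 1
    ring
  rw [h, Pber, mul_pow, mul_pow]
  ring

/-- A sub-Gaussian bound for a centred Bernoulli variable, proved by symmetrization. -/
theorem bernoulli_mgf_le {q : ℝ} (hq0 : 0 ≤ q) (hq1 : q ≤ 1) (t : ℝ) :
    q * exp (t * (1 - q)) + (1 - q) * exp (-(t * q)) ≤ exp (t ^ 2 / 2) := by
  have h1q : 0 ≤ 1 - q := sub_nonneg.2 hq1
  have hsymm : 1 ≤ q * exp (-(t * (1 - q))) + (1 - q) * exp (t * q) := by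
    nlinarith [mul_le_mul_of_nonneg_left (add_one_le_exp (-(t * (1 - q)))) hq0,
      mul_le_mul_of_nonneg_left (add_one_le_exp (t * q)) h1q]
  have hprod : (q * exp (t * (1 - q)) + (1 - q) * exp (-(t * q))) *
      (q * exp (-(t * (1 - q))) + (1 - q) * exp (t * q)) =
      1 + 2 * (q * (1 - q)) * (cosh t - 1) := by
    have e1 : exp (t * (1 - q)) * exp (-(t * (1 - q))) = 1 := by simp [← exp_add]
    have e2 : exp (-(t * q)) * exp (t * q) = 1 := by simp [← exp_add]
    have e3 : exp (t * (1 - q)) * exp (t * q) = exp t := by rw [← exp_add]; ring_nf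
    have e4 : exp (-(t * q)) * exp (-(t * (1 - q))) = exp (-t) := by rw [← exp_add]; ring_nf
    rw [cosh_eq]
    linear_combination q ^ 2 * e1 + (1 - q) ^ 2 * e2 + q * (1 - q) * e3 + q * (1 - q) * e4
  calc
    q * exp (t * (1 - q)) + (1 - q) * exp (-(t * q)) ≤ 1 + 2 * (q * (1 - q)) * (cosh t - 1) := by
      rw [← hprod]
      exact le_mul_of_one_le_right (by positivity) hsymm
    _ ≤ cosh t := by
      nlinarith [mul_nonneg (add_nonneg (sq_nonneg q) (sq_nonneg (1 - q)))
        (sub_nonneg.2 (one_le_cosh t))]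
    _ ≤ exp (t ^ 2 / 2) := cosh_le_exp_half_sq t

theorem sum_Pber_mul_exp_le {q : ℝ} (n : ℕ) (hq0 : 0 ≤ q) (hq1 : q ≤ 1) (t : ℝ) :
    ∑ x : Fin n → Bool, Pber n q x * exp (t * (hammingWt x - n * q)) ≤ exp (n * (t ^ 2 / 2)) := by
  have h1q : 0 ≤ 1 - q := sub_nonneg.2 hq1
  rw [sum_Pber_mul_exp, exp_nat_mul]
  exact pow_le_pow_left₀ (by positivity) (bernoulli_mgf_le hq0 hq1 t) n

/-- Two-sided Chernoff bound for the complement of the typical set. -/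
theorem sum_compl_Aset_Pber_le {n : ℕ} (hn : 1 ≤ n) {q ϑ : ℝ} (hq0 : 0 ≤ q) (hq1 : q ≤ 1)
    (hϑ : 0 ≤ ϑ) :
    ∑ x ∈ (Aset n q ϑ)ᶜ, Pber n q x ≤ 2 * exp (-(n * ϑ ^ 2 / 2)) := by
  have hn' : (0 : ℝ) < n := by exact_mod_cast hn
  have hpt : ∀ x ∈ (Aset n q ϑ)ᶜ, Pber n q x ≤ exp (-(n * ϑ ^ 2)) *
      (Pber n q x * exp (ϑ * (hammingWt x - n * q)) +
        Pber n q x * exp (-ϑ * (hammingWt x - n * q))) := by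
    intro x hx
    have hx' : ϑ < |(hammingWt x : ℝ) / n - q| := by simpa [Aset] using hx
    have hdev : n * ϑ ≤ |(hammingWt x : ℝ) - n * q| := by
      have h : (hammingWt x : ℝ) - n * q = n * ((hammingWt x : ℝ) / n - q) := by field_simp
      rw [h, abs_mul, abs_of_pos hn']
      gcongr
    have hexp : exp (n * ϑ ^ 2) ≤ exp (ϑ * (hammingWt x - n * q)) +
        exp (-ϑ * (hammingWt x - n * q)) := by
      rcases le_abs.1 hdev with h | h
      · exact le_add_of_le_of_nonneg (exp_le_exp.2 (by nlinarith)) (exp_pos _).le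
      · exact le_add_of_nonneg_of_le (exp_pos _).le (exp_le_exp.2 (by nlinarith))
    have hone : exp (-(n * ϑ ^ 2)) * exp (n * ϑ ^ 2) = 1 := by simp [← exp_add]
    calc
      Pber n q x = Pber n q x * (exp (-(n * ϑ ^ 2)) * exp (n * ϑ ^ 2)) := by rw [hone, mul_one]
      _ ≤ Pber n q x * (exp (-(n * ϑ ^ 2)) * (exp (ϑ * (hammingWt x - n * q)) +
          exp (-ϑ * (hammingWt x - n * q)))) :=
        mul_le_mul_of_nonneg_left (mul_le_mul_of_nonneg_left hexp (exp_pos _).le)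
          (Pber_nonneg hq0 hq1 x)
      _ = _ := by ring
  calc
    ∑ x ∈ (Aset n q ϑ)ᶜ, Pber n q x
      ≤ ∑ x ∈ (Aset n q ϑ)ᶜ, exp (-(n * ϑ ^ 2)) *
        (Pber n q x * exp (ϑ * (hammingWt x - n * q)) +
          Pber n q x * exp (-ϑ * (hammingWt x - n * q))) := sum_le_sum hpt
    _ ≤ ∑ x, exp (-(n * ϑ ^ 2)) *
        (Pber n q x * exp (ϑ * (hammingWt x - n * q)) +
          Pber n q x * exp (-ϑ * (hammingWt x - n * q))) := by
      refine sum_le_sum_of_subset_of_nonneg (subset_univ _) fun x _ _ => ?_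
      have := Pber_nonneg hq0 hq1 x
      positivity
    _ ≤ exp (-(n * ϑ ^ 2)) * (exp (n * (ϑ ^ 2 / 2)) + exp (n * ((-ϑ) ^ 2 / 2))) := by
      rw [← mul_sum, sum_add_distrib]
      gcongr
      · exact sum_Pber_mul_exp_le n hq0 hq1 ϑ
      · exact sum_Pber_mul_exp_le n hq0 hq1 (-ϑ)
    _ = 2 * exp (-(n * ϑ ^ 2 / 2)) := by
      rw [neg_sq, ← two_mul, mul_left_comm, ← exp_add]
      congr 2
      ring

/-- Conditioning a distribution on `s` moves it by the mass of `sᶜ` in total variation. -/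
theorem half_sum_abs_sub_cond {α : Type*} [Fintype α] [DecidableEq α] {p : α → ℝ}
    (hp : ∀ x, 0 ≤ p x) (hsum : ∑ x, p x = 1) {s : Finset α} (hs : 0 < ∑ x ∈ s, p x) :
    (1 / 2) * ∑ x, |p x - (if x ∈ s then p x else 0) / ∑ y ∈ s, p y| = ∑ x ∈ sᶜ, p x := by
  have htot := sum_add_sum_compl s p
  rw [hsum] at htot
  have hcompl : 0 ≤ ∑ x ∈ sᶜ, p x := sum_nonneg fun x _ => hp x
  have hin : ∑ x ∈ s, |p x - (if x ∈ s then p x else 0) / ∑ y ∈ s, p y| =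
      1 - ∑ x ∈ s, p x := by
    have h : ∀ x ∈ s, |p x - (if x ∈ s then p x else 0) / ∑ y ∈ s, p y| =
        p x / (∑ y ∈ s, p y) - p x := by
      intro x hx
      rw [if_pos hx, abs_sub_comm, abs_of_nonneg]
      exact sub_nonneg.2 (le_div_self (hp x) hs (by linarith))
    rw [sum_congr rfl h, sum_sub_distrib, ← sum_div, div_self hs.ne']
  have hout : ∑ x ∈ sᶜ, |p x - (if x ∈ s then p x else 0) / ∑ y ∈ s, p y| = ∑ x ∈ sᶜ, p x := by
    refine sum_congr rfl fun x hx => ?_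
    rw [if_neg (mem_compl.1 hx), zero_div, sub_zero, abs_of_nonneg (hp x)]
  rw [← sum_add_sum_compl s, hin, hout]
  linarith

/-- the total variation distance between the i.i.d. Bernoulli(q)
distribution `P` on `{0,1}ⁿ` and its conditioning `p_𝐗` onto the typical set
`𝒜` (assumed to have positive probability) is at most `2·exp(−(1/3)·q·n·ϑ²)`. -/
theorem stmt_12 (n : ℕ) (hn : 1 ≤ n) (q ϑ : ℝ) (hq0 : 0 < q) (hq1 : q < 1) (hϑ : 0 < ϑ)
    (hA : 0 < ∑ x ∈ Aset n q ϑ, Pber n q x) :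
    (1 / 2) *
        ∑ x : Fin n → Bool,
          |Pber n q x -
            (if x ∈ Aset n q ϑ then Pber n q x else 0) / (∑ y ∈ Aset n q ϑ, Pber n q y)|
      ≤ 2 * Real.exp (-(1 / 3) * q * n * ϑ ^ 2) := by
  rw [half_sum_abs_sub_cond (Pber_nonneg hq0.le hq1.le) (sum_Pber n q) hA]
  refine (sum_compl_Aset_Pber_le hn hq0.le hq1.le hϑ.le).trans ?_
  have h : 0 ≤ (n : ℝ) * ϑ ^ 2 := by positivity
  gcongr
  nlinarith [mul_le_mul_of_nonneg_right hq1.le h]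
end

section
/- Let p and r be probability mass functions on the nonnegative integers with r(m) > 0 for all m, let λ ∈ [0,1], and define the mixture s = (1−λ)·r + λ·p. Assume the χ²-divergence χ²(p‖r) = ∑_m (p(m) − r(m))²/r(m) is finite and that the series ∑_m s(m)·ln(s(m)/r(m)) converges (terms with s(m) = 0 contribute 0). Then the relative entropy of the mixture satisfies ∑_m s(m)·ln(s(m)/r(m)) ≤ λ²·χ²(p‖r). -/
/-- The pointwise bound `s * log (s / r) ≤ (s - r) ^ 2 / r + (s - r)`. -/
theorem mul_log_div_le_sq_div_add_sub {s r : ℝ} (hs : 0 ≤ s) (hr : 0 < r) :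
    s * Real.log (s / r) ≤ (s - r) ^ 2 / r + (s - r) := by
  have h : s * Real.log (s / r) ≤ s * (s / r - 1) := by
    rcases hs.eq_or_lt with rfl | hs'
    · simp
    · exact mul_le_mul_of_nonneg_left (Real.log_le_sub_one_of_pos (div_pos hs' hr)) hs
  refine h.trans_eq ?_
  field_simp
  ring

/-- relative-entropy vs. χ²-divergence bound for mixtures.
For probability mass functions `p, r` on `ℕ` with `r` everywhere positive,
`λ ∈ [0,1]`, and mixture `s = (1−λ)·r + λ·p`, assuming the χ²-divergence
`∑ (p−r)²/r` is finite and the series `∑ s·ln(s/r)` converges,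
`D(s‖r) = ∑ s(m)·ln(s(m)/r(m)) ≤ λ²·χ²(p‖r)`. -/
theorem stmt_13 (p r : ℕ → ℝ) (lam : ℝ)
    (hp0 : ∀ m, 0 ≤ p m) (hp1 : HasSum p 1)
    (hr0 : ∀ m, 0 < r m) (hr1 : HasSum r 1)
    (hlam0 : 0 ≤ lam) (hlam1 : lam ≤ 1)
    (hchi : Summable (fun m => (p m - r m) ^ 2 / r m))
    (hD : Summable (fun m =>
      ((1 - lam) * r m + lam * p m) *
        Real.log (((1 - lam) * r m + lam * p m) / r m))) :
    ∑' m : ℕ, ((1 - lam) * r m + lam * p m) *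
        Real.log (((1 - lam) * r m + lam * p m) / r m)
      ≤ lam ^ 2 * ∑' m : ℕ, (p m - r m) ^ 2 / r m := by
  have hsum : HasSum (fun m => lam ^ 2 * ((p m - r m) ^ 2 / r m) + lam * (p m - r m))
      (lam ^ 2 * ∑' m : ℕ, (p m - r m) ^ 2 / r m) := by
    simpa using (hchi.hasSum.mul_left (lam ^ 2)).add ((hp1.sub hr1).mul_left lam)
  refine hasSum_le (fun m => ?_) hD.hasSum hsum
  have hs : 0 ≤ (1 - lam) * r m + lam * p m :=
    add_nonneg (mul_nonneg (sub_nonneg.2 hlam1) (hr0 m).le) (mul_nonneg hlam0 (hp0 m))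
  refine (mul_log_div_le_sq_div_add_sub hs (hr0 m)).trans_eq ?_
  ring
end
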